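/- For any sufficiently smooth function u on ℝ^{1+2} supported in the cone K and any s ∈ [2,+∞), one has the Klainerman–Sobolev inequality on hyperboloids: sup_{(t,x)∈H_s} |t·u(t,x)| ≲ Σ_{|J| ≤ 2} ‖L^J u‖_{L²_f(H_s)}, with an implied constant independent of u and s. -/

import Mathlib

open MeasureTheory Real Filter Topology
open scoped ENNReal NNReal

noncomputable section

/-- A spacetime point in `ℝ^{1+2}`: coordinates `(x₀, x₁, x₂)` with `t = x₀`. -/
abbrev Pt : Type := Fin 3 → ℝ

/-- The `i`-th standard basis vector of `ℝ^{1+2}`. -/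
def e3 (i : Fin 3) : Pt := Pi.single i 1

/-- Partial derivative `∂_i`. -/
def pd (i : Fin 3) (u : Pt → ℝ) : Pt → ℝ := fun p => fderiv ℝ u p (e3 i)

/-- Spatial radius `r = |x|`. -/
def rad (p : Pt) : ℝ := Real.sqrt ((p 1) ^ 2 + (p 2) ^ 2)

/-- Hyperbolic time `s = √(t² − |x|²)`. -/
def sVar (p : Pt) : ℝ := Real.sqrt ((p 0) ^ 2 - (p 1) ^ 2 - (p 2) ^ 2)

/-- The cone `K = {(t,x) : t ≥ 2, |x| < t − 1}`. -/
def Cone : Set Pt := {p | 2 ≤ p 0 ∧ rad p < p 0 - 1}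

/-- Lorentz boost `L_a = x_a ∂_t + t ∂_a`, `a ∈ {1,2}`. -/
def Lb (a : Fin 2) (u : Pt → ℝ) : Pt → ℝ :=
  fun p => p a.succ * pd 0 u p + p 0 * pd a.succ u p

/-- Semi-hyperboloidal derivative `∂̲_a = (x_a/t)∂_t + ∂_a`. -/
def dund (a : Fin 2) (u : Pt → ℝ) : Pt → ℝ :=
  fun p => (p a.succ / p 0) * pd 0 u p + pd a.succ u p

/-- The ordered family `{Γ_k} = {∂₀, ∂₁, ∂₂, L₁, L₂}`. -/
def Gam : Fin 5 → (Pt → ℝ) → (Pt → ℝ) := ![pd 0, pd 1, pd 2, Lb 0, Lb 1]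

/-- `Γ^I = Π_k Γ_k^{i_k}` for a multi-index `I ∈ ℕ⁵`. -/
def GamI (I : Fin 5 → ℕ) : (Pt → ℝ) → (Pt → ℝ) :=
  (Gam 0)^[I 0] ∘ (Gam 1)^[I 1] ∘ (Gam 2)^[I 2] ∘ (Gam 3)^[I 3] ∘ (Gam 4)^[I 4]

/-- Length `|I|` of a multi-index. -/
def mlen (I : Fin 5 → ℕ) : ℕ := ∑ k, I k

/-- The (finite) set of multi-indices `I ∈ ℕ⁵` with `|I| ≤ n`. -/
def midxLe (n : ℕ) : Finset (Fin 5 → ℕ) :=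
  (Fintype.piFinset fun _ => Finset.range (n + 1)).filter fun I => mlen I ≤ n

/-- The (finite) set of multi-indices `I ∈ ℕ⁵` with `|I| = 1`. -/
def midxEq1 : Finset (Fin 5 → ℕ) :=
  (Fintype.piFinset fun _ => Finset.range 2).filter fun I => mlen I = 1

/-- `|∂u| = (Σ_α |∂_α u|²)^{1/2}`. -/
def pdNorm (u : Pt → ℝ) (p : Pt) : ℝ := Real.sqrt (∑ α, (pd α u p) ^ 2)

/-- The wave operator `□ = −∂_t² + ∂₁² + ∂₂²`. -/
def box (u : Pt → ℝ) : Pt → ℝ :=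
  fun p => - pd 0 (pd 0 u) p + pd 1 (pd 1 u) p + pd 2 (pd 2 u) p

/-- The null condition for constants `P^{γαβ}`. -/
def NullCond (P : Fin 3 → Fin 3 → Fin 3 → ℝ) : Prop :=
  ∀ ξ : Fin 3 → ℝ, ξ 0 ^ 2 = ξ 1 ^ 2 + ξ 2 ^ 2 →
    ∑ γ, ∑ α, ∑ β, P γ α β * ξ γ * ξ α * ξ β = 0

/-- The symmetry condition `P^{γαβ} = P^{γβα}`. -/
def SymmCond (P : Fin 3 → Fin 3 → Fin 3 → ℝ) : Prop := ∀ γ α β, P γ α β = P γ β α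

/-- Null form `N(w,z) = P^{γαβ} ∂_γ w ∂_α∂_β z`. -/
def Nform (P : Fin 3 → Fin 3 → Fin 3 → ℝ) (w z : Pt → ℝ) : Pt → ℝ :=
  fun p => ∑ γ, ∑ α, ∑ β, P γ α β * pd γ w p * pd α (pd β z) p

/-- The point of the hyperboloid `H_s` above `x ∈ ℝ²`. -/
def hypPt (s : ℝ) (x : Fin 2 → ℝ) : Pt :=
  ![Real.sqrt (s ^ 2 + (x 0) ^ 2 + (x 1) ^ 2), x 0, x 1]

/-- `‖u‖_{L²_f(H_s)}`. -/
def L2H (u : Pt → ℝ) (s : ℝ) : ℝ :=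
  (∫ x : Fin 2 → ℝ, (u (hypPt s x)) ^ 2) ^ (1 / 2 : ℝ)

/-- The hyperboloidal energy `E_m(u,s)`. -/
def Em (m : ℝ) (u : Pt → ℝ) (s : ℝ) : ℝ :=
  ∫ x : Fin 2 → ℝ,
    (((s / hypPt s x 0) * pd 0 u (hypPt s x)) ^ 2
      + ∑ a : Fin 2, (dund a u (hypPt s x)) ^ 2
      + m ^ 2 * (u (hypPt s x)) ^ 2)

/-- `K₀ = s∂_s + 2x^a∂̲_a`, where `s∂_s = (s²/t)∂_t`. -/
def K0op (u : Pt → ℝ) : Pt → ℝ :=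
  fun p => (sVar p) ^ 2 / p 0 * pd 0 u p + 2 * ∑ a : Fin 2, p a.succ * dund a u p

/-- The conformal energy `E_con(u,s)`. -/
def Econ (u : Pt → ℝ) (s : ℝ) : ℝ :=
  ∫ x : Fin 2 → ℝ,
    ((K0op u (hypPt s x) + u (hypPt s x)) ^ 2
      + ∑ a : Fin 2, (s * dund a u (hypPt s x)) ^ 2)


/-- `L^J = L₁^{j₁} L₂^{j₂}` for a multi-index `J ∈ ℕ²`. -/
def LK (J : Fin 2 → ℕ) : (Pt → ℝ) → (Pt → ℝ) := (Lb 0)^[J 0] ∘ (Lb 1)^[J 1]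

/-- The (finite) set of multi-indices `J ∈ ℕ²` with `|J| ≤ n`. -/
def midx2Le (n : ℕ) : Finset (Fin 2 → ℕ) :=
  (Fintype.piFinset fun _ => Finset.range (n + 1)).filter fun J => J 0 + J 1 ≤ n

/-- A function with integrably dominated derivative and limit zero at `-∞` is bounded by the
integral of the dominating function. -/
lemma abs_le_integral_of_hasDerivAt {f f' Q : ℝ → ℝ} (hf : ∀ x, HasDerivAt f (f' x) x)
    (h0 : Tendsto f atBot (𝓝 0)) (hQ : Integrable Q) (hle : ∀ x, |f' x| ≤ Q x) (a : ℝ) :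
    |f a| ≤ ∫ x, Q x := by
  have hf' : f' = deriv f := funext fun x => (hf x).deriv.symm
  have hint : Integrable f' :=
    hQ.mono' (hf' ▸ (measurable_deriv f).aestronglyMeasurable) (Eventually.of_forall hle)
  have heq : ∫ x in Set.Iic a, f' x = f a - 0 :=
    integral_Iic_of_hasDerivAt_of_tendsto' (fun x _ => hf x) hint.integrableOn h0
  rw [sub_zero] at heq
  rw [← heq]
  calc |∫ x in Set.Iic a, f' x| ≤ ∫ x in Set.Iic a, |f' x| := abs_integral_le_integral_abs
    _ ≤ ∫ x, |f' x| :=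
      setIntegral_le_integral hint.abs (Eventually.of_forall fun x => abs_nonneg _)
    _ ≤ ∫ x, Q x := integral_mono hint.abs hQ hle

/-- A function on the plane is bounded by the integral of any continuous, compactly supported
majorant of its mixed second derivative. -/
lemma abs_le_integral_of_hasDerivAt_mixed {g h k : ℝ → ℝ → ℝ} {Q : ℝ × ℝ → ℝ}
    (hg : ∀ a b, HasDerivAt (fun y => g a y) (h a b) b)
    (hh : ∀ a b, HasDerivAt (fun x => h x b) (k a b) a)
    (hg0 : ∀ a, Tendsto (fun y => g a y) atBot (𝓝 0))
    (hh0 : ∀ b, Tendsto (fun x => h x b) atBot (𝓝 0))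
    (hQ : Continuous Q) (hQc : HasCompactSupport Q)
    (hle : ∀ a b, |k a b| ≤ Q (a, b)) (a b : ℝ) :
    |g a b| ≤ ∫ p, Q p := by
  have hQi : Integrable Q := hQ.integrable_of_hasCompactSupport hQc
  have hslice : ∀ y, Integrable fun x => Q (x, y) := fun y =>
    (hQ.comp (by fun_prop : Continuous fun x : ℝ => (x, y))).integrable_of_hasCompactSupport <|
      hQc.comp_isClosedEmbedding (Function.LeftInverse.isClosedEmbedding
        (f := Prod.fst) (fun _ => rfl) continuous_fst (by fun_prop))
  have hb : ∀ y, |h a y| ≤ ∫ x, Q (x, y) := fun y =>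
    abs_le_integral_of_hasDerivAt (fun x => hh x y) (hh0 y) (hslice y) (fun x => hle x y) a
  have key := abs_le_integral_of_hasDerivAt (fun y => hg a y) (hg0 a) hQi.integral_prod_right hb b
  rwa [Measure.volume_eq_prod, integral_prod_symm Q hQi]

lemma hypPt_zero_sq (s : ℝ) (x : Fin 2 → ℝ) :
    hypPt s x 0 ^ 2 = s ^ 2 + x 0 ^ 2 + x 1 ^ 2 :=
  Real.sq_sqrt (by positivity)

lemma hypPt_zero_pos {s : ℝ} (hs : 0 < s) (x : Fin 2 → ℝ) : 0 < hypPt s x 0 :=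
  Real.sqrt_pos.2 (by positivity)

lemma abs_div_hypPt_zero_le_one {s : ℝ} (hs : 0 < s) (x : Fin 2 → ℝ) (i : Fin 2) :
    |x i / hypPt s x 0| ≤ 1 := by
  rw [abs_div, abs_of_pos (hypPt_zero_pos hs x), div_le_one (hypPt_zero_pos hs x)]
  refine abs_le_of_sq_le_sq ?_ (hypPt_zero_pos hs x).le
  rw [hypPt_zero_sq]
  fin_cases i <;> simp <;> nlinarith [sq_nonneg s, sq_nonneg (x 0), sq_nonneg (x 1)]

lemma continuous_hypPt (s : ℝ) : Continuous (hypPt s) := by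
  unfold hypPt
  refine continuous_pi fun i => ?_
  fin_cases i <;> simp <;> fun_prop

lemma hasDerivAt_hypPt_zero_left {s : ℝ} (hs : 0 < s) (a b : ℝ) :
    HasDerivAt (fun x => hypPt s ![x, b] 0) (a / hypPt s ![a, b] 0) a := by
  have h1 : HasDerivAt (fun x : ℝ => s ^ 2 + x ^ 2 + b ^ 2) (2 * a) a := by
    simpa using (((hasDerivAt_id a).pow 2).const_add (s ^ 2)).add_const (b ^ 2)
  exact (h1.sqrt (by positivity)).congr_deriv (mul_div_mul_left a _ two_ne_zero)

lemma hasDerivAt_hypPt_zero_right {s : ℝ} (hs : 0 < s) (a b : ℝ) :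
    HasDerivAt (fun y => hypPt s ![a, y] 0) (b / hypPt s ![a, b] 0) b := by
  have h1 : HasDerivAt (fun y : ℝ => s ^ 2 + a ^ 2 + y ^ 2) (2 * b) b := by
    simpa using ((hasDerivAt_id b).pow 2).const_add (s ^ 2 + a ^ 2)
  exact (h1.sqrt (by positivity)).congr_deriv (mul_div_mul_left b _ two_ne_zero)

lemma fderiv_apply_eq_sum_pd (u : Pt → ℝ) (p v : Pt) :
    fderiv ℝ u p v = v 0 * pd 0 u p + v 1 * pd 1 u p + v 2 * pd 2 u p := by
  have hv : v = v 0 • e3 0 + v 1 • e3 1 + v 2 • e3 2 := by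
    ext i
    fin_cases i <;> simp [e3]
  conv_lhs => rw [hv]
  simp [pd]

/-- Along a hyperboloid, the boost `L₁` acts as `t ∂₁`. -/
lemma hasDerivAt_comp_hypPt_left {u : Pt → ℝ} (hu : Differentiable ℝ u) {s : ℝ} (hs : 0 < s)
    (a b : ℝ) :
    HasDerivAt (fun x => u (hypPt s ![x, b]))
      (Lb 0 u (hypPt s ![a, b]) / hypPt s ![a, b] 0) a := by
  have hP : HasDerivAt (fun x => hypPt s ![x, b]) ![a / hypPt s ![a, b] 0, 1, 0] a := by
    refine hasDerivAt_pi.2 fun i => ?_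
    fin_cases i
    · exact hasDerivAt_hypPt_zero_left hs a b
    · exact hasDerivAt_id a
    · exact hasDerivAt_const a b
  refine ((hu _).hasFDerivAt.comp_hasDerivAt a hP).congr_deriv ?_
  have h0 := (hypPt_zero_pos hs ![a, b]).ne'
  rw [fderiv_apply_eq_sum_pd]
  have h1 : hypPt s ![a, b] (Fin.succ 0) = a := rfl
  simp only [Lb, h1]
  simp
  field_simp

/-- Along a hyperboloid, the boost `L₂` acts as `t ∂₂`. -/
lemma hasDerivAt_comp_hypPt_right {u : Pt → ℝ} (hu : Differentiable ℝ u) {s : ℝ} (hs : 0 < s)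
    (a b : ℝ) :
    HasDerivAt (fun y => u (hypPt s ![a, y]))
      (Lb 1 u (hypPt s ![a, b]) / hypPt s ![a, b] 0) b := by
  have hP : HasDerivAt (fun y => hypPt s ![a, y]) ![b / hypPt s ![a, b] 0, 0, 1] b := by
    refine hasDerivAt_pi.2 fun i => ?_
    fin_cases i
    · exact hasDerivAt_hypPt_zero_right hs a b
    · exact hasDerivAt_const b a
    · exact hasDerivAt_id b
  refine ((hu _).hasFDerivAt.comp_hasDerivAt b hP).congr_deriv ?_
  have h0 := (hypPt_zero_pos hs ![a, b]).ne'
  rw [fderiv_apply_eq_sum_pd]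
  have h1 : hypPt s ![a, b] (Fin.succ 1) = b := rfl
  simp only [Lb, h1]
  simp
  field_simp

lemma contDiff_pd {u : Pt → ℝ} (hu : ContDiff ℝ (⊤ : ℕ∞) u) (i : Fin 3) :
    ContDiff ℝ (⊤ : ℕ∞) (pd i u) :=
  (hu.fderiv_right (m := (⊤ : ℕ∞)) (by simp)).clm_apply contDiff_const

lemma contDiff_Lb {u : Pt → ℝ} (hu : ContDiff ℝ (⊤ : ℕ∞) u) (a : Fin 2) :
    ContDiff ℝ (⊤ : ℕ∞) (Lb a u) :=
  ((contDiff_apply ℝ ℝ a.succ).mul (contDiff_pd hu 0)).add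
    ((contDiff_apply ℝ ℝ 0).mul (contDiff_pd hu a.succ))

lemma tsupport_Lb_subset (a : Fin 2) (u : Pt → ℝ) : tsupport (Lb a u) ⊆ tsupport u := by
  refine closure_minimal (fun p hp => ?_) (isClosed_tsupport u)
  by_contra hpu
  have h0 : fderiv ℝ u p = 0 := by
    by_contra h
    exact hpu (support_fderiv_subset ℝ h)
  exact hp (by simp [Lb, pd, h0])

lemma tsupport_subset_of_support_subset_Cone {u : Pt → ℝ} (hu : Function.support u ⊆ Cone) :
    tsupport u ⊆ {p | rad p ≤ p 0 - 1} := by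
  refine closure_minimal (fun p hp => (hu hp).2.le) (isClosed_le ?_ (by fun_prop))
  unfold rad
  fun_prop

/-- The part of a hyperboloid inside the cone lies over a bounded set. -/
lemma comp_hypPt_eq_zero {u : Pt → ℝ} (hu : tsupport u ⊆ {p | rad p ≤ p 0 - 1}) {s : ℝ}
    {x : Fin 2 → ℝ} {i : Fin 2} (hx : s ^ 2 < |x i|) : u (hypPt s x) = 0 := by
  by_contra hne
  have h1 : √(x 0 ^ 2 + x 1 ^ 2) ≤ hypPt s x 0 - 1 := hu (subset_tsupport u hne)
  have h2 := hypPt_zero_sq s x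
  have h3 : √(x 0 ^ 2 + x 1 ^ 2) ^ 2 = x 0 ^ 2 + x 1 ^ 2 := Real.sq_sqrt (by positivity)
  have h4 : |x i| ≤ √(x 0 ^ 2 + x 1 ^ 2) := by
    refine Real.abs_le_sqrt ?_
    fin_cases i <;> simp <;> positivity
  nlinarith [Real.sqrt_nonneg (x 0 ^ 2 + x 1 ^ 2), sq_nonneg s]

lemma hasCompactSupport_comp_hypPt {u : Pt → ℝ} (hu : tsupport u ⊆ {p | rad p ≤ p 0 - 1})
    (s : ℝ) : HasCompactSupport fun x => u (hypPt s x) := by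
  refine HasCompactSupport.intro (isCompact_closedBall (0 : Fin 2 → ℝ) (s ^ 2)) fun x hx => ?_
  rw [mem_closedBall_zero_iff, pi_norm_le_iff_of_nonneg (sq_nonneg s)] at hx
  push Not at hx
  obtain ⟨i, hi⟩ := hx
  exact comp_hypPt_eq_zero hu hi

lemma integrable_comp_hypPt_sq {u : Pt → ℝ} (hc : Continuous u)
    (hu : tsupport u ⊆ {p | rad p ≤ p 0 - 1}) (s : ℝ) :
    Integrable fun x => u (hypPt s x) ^ 2 := by
  have hcont : Continuous fun x => u (hypPt s x) ^ 2 := (hc.comp (continuous_hypPt s)).pow 2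
  have hcomp : HasCompactSupport fun x => u (hypPt s x) ^ 2 :=
    (hasCompactSupport_comp_hypPt hu s).comp_left (g := fun y : ℝ => y ^ 2) (by simp)
  exact hcont.integrable_of_hasCompactSupport hcomp

lemma L2H_nonneg (u : Pt → ℝ) (s : ℝ) : 0 ≤ L2H u s :=
  Real.rpow_nonneg (integral_nonneg fun _ => sq_nonneg _) _

lemma L2H_sq (u : Pt → ℝ) (s : ℝ) : L2H u s ^ 2 = ∫ x, u (hypPt s x) ^ 2 := by
  rw [L2H, ← Real.sqrt_eq_rpow, Real.sq_sqrt (integral_nonneg fun _ => sq_nonneg _)]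

lemma tendsto_atBot_of_vanishing {f : ℝ → ℝ} {R : ℝ} (hf : ∀ x, R < |x| → f x = 0) :
    Tendsto f atBot (𝓝 0) := by
  refine tendsto_const_nhds.congr' ?_
  filter_upwards [eventually_lt_atBot (-R)] with x hx
  exact (hf x (by linarith [neg_abs_le x])).symm

/-- The square of the weighted pointwise value is controlled by four squared `L²` norms. -/
lemma sq_hypPt_zero_mul_le {u : Pt → ℝ} (hu : ContDiff ℝ (⊤ : ℕ∞) u)
    (hsupp : Function.support u ⊆ Cone) {s : ℝ} (hs : 0 < s) (x : Fin 2 → ℝ) :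
    (hypPt s x 0 * u (hypPt s x)) ^ 2 ≤
      4 * L2H u s ^ 2 + 3 * L2H (Lb 0 u) s ^ 2 + 2 * L2H (Lb 1 u) s ^ 2
        + L2H (Lb 0 (Lb 1 u)) s ^ 2 := by
  have hA := contDiff_Lb hu 0
  have hB := contDiff_Lb hu 1
  have hD := contDiff_Lb hB 0
  have su := tsupport_subset_of_support_subset_Cone hsupp
  have sA := (tsupport_Lb_subset 0 u).trans su
  have sB := (tsupport_Lb_subset 1 u).trans su
  have sD := (tsupport_Lb_subset 0 (Lb 1 u)).trans sB
  have iu := integrable_comp_hypPt_sq hu.continuous su s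
  have iA := integrable_comp_hypPt_sq hA.continuous sA s
  have iB := integrable_comp_hypPt_sq hB.continuous sB s
  have iD := integrable_comp_hypPt_sq hD.continuous sD s
  have du := hu.differentiable (by simp)
  have dB := hB.differentiable (by simp)
  set q : Pt → ℝ := fun p =>
    4 * u p ^ 2 + 3 * Lb 0 u p ^ 2 + 2 * Lb 1 u p ^ 2 + Lb 0 (Lb 1 u) p ^ 2 with hq
  have hqc : Continuous q := by
    have := hu.continuous
    have := hA.continuous
    have := hB.continuous
    have := hD.continuous
    fun_prop
  have sq' : tsupport q ⊆ {p | rad p ≤ p 0 - 1} := by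
    refine subset_trans (closure_minimal (fun p hp => ?_) (isClosed_tsupport u)) su
    by_contra hpu
    have h1 := image_eq_zero_of_notMem_tsupport hpu
    have h2 := image_eq_zero_of_notMem_tsupport fun h => hpu (tsupport_Lb_subset 0 u h)
    have h3 := image_eq_zero_of_notMem_tsupport fun h => hpu (tsupport_Lb_subset 1 u h)
    have h4 := image_eq_zero_of_notMem_tsupport fun h =>
      hpu (tsupport_Lb_subset 1 u (tsupport_Lb_subset 0 (Lb 1 u) h))
    exact hp (by simp [hq, h1, h2, h3, h4])
  have hint : ∫ y, q (hypPt s y) =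
      4 * L2H u s ^ 2 + 3 * L2H (Lb 0 u) s ^ 2 + 2 * L2H (Lb 1 u) s ^ 2
        + L2H (Lb 0 (Lb 1 u)) s ^ 2 := by
    simp only [L2H_sq, hq]
    have i2 : Integrable fun y => 4 * u (hypPt s y) ^ 2 + 3 * Lb 0 u (hypPt s y) ^ 2 :=
      (iu.const_mul 4).add (iA.const_mul 3)
    have i3 : Integrable fun y => 4 * u (hypPt s y) ^ 2 + 3 * Lb 0 u (hypPt s y) ^ 2
        + 2 * Lb 1 u (hypPt s y) ^ 2 := i2.add (iB.const_mul 2)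
    rw [integral_add i3 iD, integral_add i2 (iB.const_mul 2),
      integral_add (iu.const_mul 4) (iA.const_mul 3)]
    simp only [integral_const_mul]
  have hx : x = ![x 0, x 1] := by
    ext i
    fin_cases i <;> rfl
  have hmp := volume_preserving_finTwoArrow ℝ
  have hcov : ∫ z : ℝ × ℝ, q (hypPt s ![z.1, z.2]) = ∫ y, q (hypPt s y) := by
    rw [← hmp.integral_comp' (fun z : ℝ × ℝ => q (hypPt s ![z.1, z.2]))]
    refine integral_congr_ae (Eventually.of_forall fun y => ?_)
    have hy : y = ![y 0, y 1] := by
      ext i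
      fin_cases i <;> rfl
    change q (hypPt s ![y 0, y 1]) = q (hypPt s y)
    rw [← hy]
  rw [← hint, ← hcov]
  have hcont : Continuous fun z : ℝ × ℝ => q (hypPt s ![z.1, z.2]) := by
    refine hqc.comp ((continuous_hypPt s).comp (continuous_pi fun i => ?_))
    fin_cases i
    · exact continuous_fst
    · exact continuous_snd
  have hcomp : HasCompactSupport fun z : ℝ × ℝ => q (hypPt s ![z.1, z.2]) :=
    (hasCompactSupport_comp_hypPt sq' s).comp_homeomorph Homeomorph.finTwoArrow.symm
  have key := abs_le_integral_of_hasDerivAt_mixed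
    (g := fun a b => (hypPt s ![a, b] 0 * u (hypPt s ![a, b])) ^ 2)
    (h := fun a b => 2 * b * u (hypPt s ![a, b]) ^ 2
      + 2 * (hypPt s ![a, b] 0 * (u (hypPt s ![a, b]) * Lb 1 u (hypPt s ![a, b]))))
    (k := fun a b => 4 * (b / hypPt s ![a, b] 0) * (u (hypPt s ![a, b]) * Lb 0 u (hypPt s ![a, b]))
      + 2 * (a / hypPt s ![a, b] 0) * (u (hypPt s ![a, b]) * Lb 1 u (hypPt s ![a, b]))
      + 2 * (Lb 0 u (hypPt s ![a, b]) * Lb 1 u (hypPt s ![a, b]))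
      + 2 * (u (hypPt s ![a, b]) * Lb 0 (Lb 1 u) (hypPt s ![a, b])))
    (fun a b => ?_) (fun a b => ?_) (fun a => ?_) (fun b => ?_) hcont hcomp (fun a b => ?_)
    (x 0) (x 1)
  · rw [← hx] at key
    exact (le_abs_self _).trans key
  · have h0 := (hypPt_zero_pos hs ![a, b]).ne'
    refine (((hasDerivAt_hypPt_zero_right hs a b).mul
      (hasDerivAt_comp_hypPt_right du hs a b)).pow 2).congr_deriv ?_
    simp only [Pi.mul_apply, Nat.cast_ofNat, Nat.add_one_sub_one, pow_one]
    field_simp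
  · have h0 := (hypPt_zero_pos hs ![a, b]).ne'
    refine ((((hasDerivAt_comp_hypPt_left du hs a b).pow 2).const_mul (2 * b)).add
      (((hasDerivAt_hypPt_zero_left hs a b).mul ((hasDerivAt_comp_hypPt_left du hs a b).mul
        (hasDerivAt_comp_hypPt_left dB hs a b))).const_mul 2)).congr_deriv ?_
    simp only [Pi.mul_apply, Nat.cast_ofNat, Nat.add_one_sub_one, pow_one]
    field_simp
    ring
  · refine tendsto_atBot_of_vanishing (R := s ^ 2) fun y hy => ?_
    rw [comp_hypPt_eq_zero su (x := ![a, y]) (i := 1) (by simpa using hy)]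
    simp
  · refine tendsto_atBot_of_vanishing (R := s ^ 2) fun y hy => ?_
    rw [comp_hypPt_eq_zero su (x := ![y, b]) (i := 0) (by simpa using hy)]
    simp
  · have ha : |a / hypPt s ![a, b] 0| ≤ 1 := abs_div_hypPt_zero_le_one hs ![a, b] 0
    have hb : |b / hypPt s ![a, b] 0| ≤ 1 := abs_div_hypPt_zero_le_one hs ![a, b] 1
    have amgm : ∀ c y z : ℝ, |c| ≤ 1 → 2 * |c * (y * z)| ≤ y ^ 2 + z ^ 2 := fun c y z hc => by
      have h1 : |c| * (|y| * |z|) ≤ 1 * (|y| * |z|) := by gcongr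
      rw [abs_mul, abs_mul]
      nlinarith [sq_nonneg (|y| - |z|), sq_abs y, sq_abs z]
    simp only [hq]
    generalize hypPt s ![a, b] = p at *
    have h1 := abs_le.1 (le_div_iff₀' (by norm_num : (0 : ℝ) < 2) |>.2 (amgm _ (u p) (Lb 0 u p) hb))
    have h2 := abs_le.1 (le_div_iff₀' (by norm_num : (0 : ℝ) < 2) |>.2 (amgm _ (u p) (Lb 1 u p) ha))
    have h3 := abs_le.1 (le_div_iff₀' (by norm_num : (0 : ℝ) < 2) |>.2
      (amgm 1 (Lb 0 u p) (Lb 1 u p) (by simp)))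
    have h4 := abs_le.1 (le_div_iff₀' (by norm_num : (0 : ℝ) < 2) |>.2
      (amgm 1 (u p) (Lb 0 (Lb 1 u) p) (by simp)))
    rw [abs_le]
    constructor <;> linarith [h1.1, h1.2, h2.1, h2.2, h3.1, h3.2, h4.1, h4.2]

/-- Klainerman–Sobolev inequality on hyperboloids (`t`-weighted version). -/
theorem klainerman_sobolev_t :
    ∃ C > (0:ℝ), ∀ u : Pt → ℝ,
      ContDiff ℝ (⊤ : ℕ∞) u → Function.support u ⊆ Cone →
      ∀ s : ℝ, 2 ≤ s → ∀ x : Fin 2 → ℝ,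
        |hypPt s x 0 * u (hypPt s x)| ≤ C * ∑ J ∈ midx2Le 2, L2H (LK J u) s := by
  refine ⟨2, two_pos, fun u hu hsupp s hs x => ?_⟩
  have hkey := sq_hypPt_zero_mul_le hu hsupp (by linarith : 0 < s) x
  have hsum : L2H u s + L2H (Lb 0 u) s + L2H (Lb 1 u) s + L2H (Lb 0 (Lb 1 u)) s ≤
      ∑ J ∈ midx2Le 2, L2H (LK J u) s := by
    have hsub : ({![0, 0], ![1, 0], ![0, 1], ![1, 1]} : Finset (Fin 2 → ℕ)) ⊆ midx2Le 2 := by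
      decide
    refine le_trans (le_of_eq ?_)
      (Finset.sum_le_sum_of_subset_of_nonneg hsub fun J _ _ => L2H_nonneg _ _)
    rw [Finset.sum_insert (by decide), Finset.sum_insert (by decide),
      Finset.sum_insert (by decide), Finset.sum_singleton]
    simp [LK, add_assoc]
  have n1 := L2H_nonneg u s
  have n2 := L2H_nonneg (Lb 0 u) s
  have n3 := L2H_nonneg (Lb 1 u) s
  have n4 := L2H_nonneg (Lb 0 (Lb 1 u)) s
  refine le_trans (abs_le_of_sq_le_sq ?_ (by positivity))
    (mul_le_mul_of_nonneg_left hsum two_pos.le)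
  nlinarith [mul_nonneg n1 n2, mul_nonneg n1 n3, mul_nonneg n1 n4, mul_nonneg n2 n3,
    mul_nonneg n2 n4, mul_nonneg n3 n4, sq_nonneg (L2H (Lb 0 u) s), sq_nonneg (L2H (Lb 1 u) s),
    sq_nonneg (L2H (Lb 0 (Lb 1 u)) s)]
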